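/- Under the stated assumptions, there exist a constant C > 0 and N₀ such that for all n ≥ N₀, Pⁿ( sup_{t ∈ [t₁,t₂]} |σ̂_n(t)/σ(t) − 1| ≥ C (log n)^{1/2} n^{−1/2} ) ≤ 2/n. -/

import Mathlib

open MeasureTheory Set

noncomputable section

/-- A landscape-type function for `T`: 1-Lipschitz, with values in `[0, T/2]`,
and vanishing outside `[0, T]`. -/
def IsLandscapeType (T : ℝ) (f : ℝ → ℝ) : Prop :=
  LipschitzWith 1 f ∧ (∀ t, 0 ≤ f t ∧ f t ≤ T / 2) ∧ ∀ t ∉ Set.Icc (0 : ℝ) T, f t = 0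

/-- The Borel σ-algebra on the space `C(ℝ, ℝ)` of continuous functions with the
topology of uniform convergence on compact sets (the compact-open topology). -/
instance : MeasurableSpace C(ℝ, ℝ) := borel _

instance : BorelSpace C(ℝ, ℝ) := ⟨rfl⟩

/-- The mean function `μ(t) = ∫ λ(t) dP(λ)`. -/
def lmean (P : Measure C(ℝ, ℝ)) (t : ℝ) : ℝ := ∫ f, f t ∂P

/-- The variance function `σ(t)² = ∫ λ(t)² dP(λ) − μ(t)²`. -/
def lvar (P : Measure C(ℝ, ℝ)) (t : ℝ) : ℝ := (∫ f, (f t) ^ 2 ∂P) - (lmean P t) ^ 2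

/-- The standard deviation function `σ(t)`. -/
def lsd (P : Measure C(ℝ, ℝ)) (t : ℝ) : ℝ := Real.sqrt (lvar P t)

/-- The empirical average `λ̄_n(t) = (1/n) Σ_i λ_i(t)` of a tuple of functions. -/
def empMean (n : ℕ) (l : Fin n → C(ℝ, ℝ)) (t : ℝ) : ℝ := (∑ i, l i t) / n

/-- The empirical standard deviation
`σ̂_n(t) = sqrt((1/n) Σ_i λ_i(t)² − λ̄_n(t)²)` of a tuple of functions. -/
def empSD (n : ℕ) (l : Fin n → C(ℝ, ℝ)) (t : ℝ) : ℝ :=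
  Real.sqrt ((∑ i, (l i t) ^ 2) / n - (empMean n l t) ^ 2)

/-- Two-sided Hoeffding inequality for the i.i.d. coordinates of a product measure. -/
theorem measure_pi_abs_sum_sub_integral_ge_le {Ω : Type*} [MeasurableSpace Ω] (P : Measure Ω)
    [IsProbabilityMeasure P] {X : Ω → ℝ} (hX : Measurable X) {B : ℝ}
    (hB : ∀ᵐ ω ∂P, X ω ∈ Icc 0 B) (n : ℕ) {ε : ℝ} (hε : 0 ≤ ε) :
    (Measure.pi fun _ : Fin n => P).real {l | ε ≤ |∑ i, (X (l i) - ∫ ω, X ω ∂P)|}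
      ≤ 2 * Real.exp (-2 * ε ^ 2 / (n * B ^ 2)) := by
  set Q : Measure (Fin n → Ω) := Measure.pi fun _ : Fin n => P
  have hsub (i : Fin n) : ProbabilityTheory.HasSubgaussianMGF
      (fun l : Fin n → Ω => X (l i) - ∫ ω, X ω ∂P) ((‖B - 0‖₊ / 2) ^ 2) Q := by
    have hmp : MeasurePreserving (fun l : Fin n → Ω => l i) Q P :=
      measurePreserving_eval (fun _ : Fin n => P) i
    have hmean : ∫ l, X (l i) ∂Q = ∫ ω, X ω ∂P := by
      rw [← hmp.map_eq, integral_map hmp.aemeasurable hX.aestronglyMeasurable]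
    have h := ProbabilityTheory.hasSubgaussianMGF_of_mem_Icc (μ := Q)
      (X := fun l : Fin n → Ω => X (l i)) (hX.comp hmp.measurable).aemeasurable
      (hmp.quasiMeasurePreserving.ae hB)
    rwa [hmean] at h
  have hind : ProbabilityTheory.iIndepFun
      (fun (i : Fin n) (l : Fin n → Ω) => X (l i) - ∫ ω, X ω ∂P) Q :=
    ProbabilityTheory.iIndepFun_pi (X := fun (_ : Fin n) ω => X ω - ∫ ω, X ω ∂P)
      fun _ => (hX.sub_const _).aemeasurable
  have hsum := ProbabilityTheory.HasSubgaussianMGF.sum_of_iIndepFun hind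
    (s := Finset.univ) fun i _ => hsub i
  have hexp : -ε ^ 2 / (2 * ((∑ _i : Fin n, (‖B - 0‖₊ / 2) ^ 2 : NNReal) : ℝ))
      = -2 * ε ^ 2 / (n * B ^ 2) := by
    have : (2 * ((∑ _i : Fin n, (‖B - 0‖₊ / 2) ^ 2 : NNReal) : ℝ)) = (n * B ^ 2) / 2 := by
      simp [div_pow]
      ring
    rw [this, div_div_eq_mul_div]
    ring
  have hup := hsum.measure_ge_le hε
  have hlo := hsum.neg.measure_ge_le hε
  rw [hexp] at hup hlo
  calc
    Q.real {l | ε ≤ |∑ i, (X (l i) - ∫ ω, X ω ∂P)|}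
    _ ≤ Q.real ({l | ε ≤ ∑ i, (X (l i) - ∫ ω, X ω ∂P)}
          ∪ {l | ε ≤ (-fun l : Fin n → Ω => ∑ i, (X (l i) - ∫ ω, X ω ∂P)) l}) :=
        measureReal_mono fun l (hl : ε ≤ |_|) => le_abs.1 hl
    _ ≤ 2 * Real.exp (-2 * ε ^ 2 / (n * B ^ 2)) :=
        (measureReal_union_le _ _).trans (by linarith)

theorem one_div_le_sqrt_log_div_sqrt {n : ℕ} (hn : 3 ≤ n) :
    1 / (n : ℝ) ≤ Real.sqrt (Real.log n) / Real.sqrt n := by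
  have hn' : (3 : ℝ) ≤ n := by exact_mod_cast hn
  have hlog : 1 ≤ Real.log n := by
    rw [Real.le_log_iff_exp_le (by linarith)]
    linarith [Real.exp_one_lt_three]
  refine div_le_div₀ (Real.sqrt_nonneg _) (Real.one_le_sqrt.2 hlog) (Real.sqrt_pos.2 (by linarith)) ?_
  exact Real.sqrt_le_self_iff.2 (Or.inr (by linarith))

/-- Uniform deviation bound over a compact interval for empirical means of a bounded process
with Lipschitz paths. -/
theorem measure_pi_exists_deviation_ge_le {Ω : Type*} [MeasurableSpace Ω] (P : Measure Ω)
    [IsProbabilityMeasure P] {F : Ω → ℝ → ℝ} (hF : ∀ t, Measurable fun ω => F ω t) {B K a b : ℝ}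
    (hB : 0 < B) (hK : 0 ≤ K) (hab : a < b) (hbound : ∀ᵐ ω ∂P, ∀ t, F ω t ∈ Icc 0 B)
    (hLip : ∀ᵐ ω ∂P, ∀ s t, |F ω s - F ω t| ≤ K * |s - t|) {n : ℕ} (hn : 3 ≤ n) :
    (Measure.pi fun _ : Fin n => P) {l | ∃ t ∈ Icc a b,
        (2 * B + 2 * K * (b - a)) * (Real.sqrt (Real.log n) / Real.sqrt n)
          ≤ |(∑ i, F (l i) t) / n - ∫ ω, F ω t ∂P|} ≤ 1 / n := by
  set Q : Measure (Fin n → Ω) := Measure.pi fun _ : Fin n => P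
  set r : ℝ := Real.sqrt (Real.log n) / Real.sqrt n with hr
  have hn' : (3 : ℝ) ≤ n := by exact_mod_cast hn
  have hn0 : (0 : ℝ) < n := by linarith
  have hL : 0 < b - a := sub_pos.2 hab
  have hr0 : 1 / (n : ℝ) ≤ r := one_div_le_sqrt_log_div_sqrt hn
  have hrpos : 0 < r := lt_of_lt_of_le (by positivity) hr0
  have hlog : 0 ≤ Real.log n := Real.log_nonneg (by linarith)
  have hr2 : r ^ 2 = Real.log n / n := by
    rw [hr, div_pow, Real.sq_sqrt hlog, Real.sq_sqrt hn0.le]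
  have hint (t : ℝ) : Integrable (fun ω => F ω t) P :=
    Integrable.of_mem_Icc 0 B (hF t).aemeasurable (hbound.mono fun ω h => h t)
  have hmeanLip (s t : ℝ) : |∫ ω, F ω s ∂P - ∫ ω, F ω t ∂P| ≤ K * |s - t| := by
    rw [← integral_sub (hint s) (hint t)]
    simpa using norm_integral_le_of_norm_le_const (μ := P)
      (f := fun ω => F ω s - F ω t) (hLip.mono fun ω h => h s t)
  let g (j : ℕ) : ℝ := a + j * ((b - a) / n)
  let E (j : ℕ) : Set (Fin n → Ω) :=
    {l | n * (2 * B * r) ≤ |∑ i, (F (l i) (g j) - ∫ ω, F ω (g j) ∂P)|}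
  have hE (j : ℕ) : Q.real (E j) ≤ 2 * (1 / (n : ℝ) ^ 8) := by
    refine (measure_pi_abs_sum_sub_integral_ge_le P (hF (g j)) (hbound.mono fun ω h => h _) n
      (by positivity)).trans_eq ?_
    have : -2 * (n * (2 * B * r)) ^ 2 / (n * B ^ 2) = -(8 * Real.log n) := by
      rw [mul_pow, mul_pow, hr2]
      field_simp
      ring
    rw [this, Real.exp_neg, mul_comm 8, Real.exp_mul, Real.exp_log hn0]
    norm_num
  have hae : ∀ᵐ l ∂Q, ∀ i, ∀ s t, |F (l i) s - F (l i) t| ≤ K * |s - t| :=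
    ae_all_iff.2 fun i =>
      (measurePreserving_eval (fun _ : Fin n => P) i).quasiMeasurePreserving.ae hLip
  have hcover : ({l | ∃ t ∈ Icc a b, (2 * B + 2 * K * (b - a)) * r
      ≤ |(∑ i, F (l i) t) / n - ∫ ω, F ω t ∂P|} : Set _) ≤ᵐ[Q] ⋃ j ∈ Finset.range (n + 1), E j := by
    filter_upwards [hae] with l hl
    rintro ⟨t, ⟨hat, htb⟩, ht⟩
    let x : ℝ := (t - a) / ((b - a) / n)
    have hd : 0 < (b - a) / n := by positivity
    have hx0 : 0 ≤ x := div_nonneg (sub_nonneg.2 hat) hd.le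
    have hxn : x ≤ n := by
      rw [div_le_iff₀ hd, mul_div_cancel₀ _ hn0.ne']
      linarith
    have hxt : t - a = x * ((b - a) / n) := (div_mul_cancel₀ _ hd.ne').symm
    have hdist : |t - g ⌊x⌋₊| ≤ (b - a) * r := by
      have h1 : t - g ⌊x⌋₊ = (x - ⌊x⌋₊) * ((b - a) / n) := by
        simp only [g]
        linarith
      have h2 := Nat.floor_le hx0
      have h3 := Nat.lt_floor_add_one x
      rw [h1, abs_of_nonneg (mul_nonneg (by linarith) hd.le)]
      calc
        _ ≤ 1 * ((b - a) / n) := by gcongr; linarith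
        _ = (b - a) * (1 / n) := by ring
        _ ≤ _ := by gcongr
    have hemp : |(∑ i, F (l i) t) / n - (∑ i, F (l i) (g ⌊x⌋₊)) / n| ≤ K * |t - g ⌊x⌋₊| := by
      rw [← sub_div, ← Finset.sum_sub_distrib, abs_div, abs_of_pos hn0, div_le_iff₀ hn0]
      refine (Finset.abs_sum_le_sum_abs _ _).trans
        ((Finset.sum_le_sum fun i _ => hl i t (g ⌊x⌋₊)).trans_eq ?_)
      simp [mul_comm]
    have hKd : K * |t - g ⌊x⌋₊| ≤ K * ((b - a) * r) := by gcongr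
    have hmean := hmeanLip t (g ⌊x⌋₊)
    refine mem_biUnion (x := ⌊x⌋₊) ?_ ?_
    · simpa [Nat.lt_succ_iff] using Nat.floor_le_of_le hxn
    · have hsplit : |∑ i, (F (l i) (g ⌊x⌋₊) - ∫ ω, F ω (g ⌊x⌋₊) ∂P)|
          = n * |(∑ i, F (l i) (g ⌊x⌋₊)) / n - ∫ ω, F ω (g ⌊x⌋₊) ∂P| := by
        rw [← abs_of_pos hn0, ← abs_mul, abs_of_pos hn0, mul_sub, mul_div_cancel₀ _ hn0.ne']
        simp
      change n * (2 * B * r) ≤ _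
      rw [hsplit]
      gcongr
      have htri : |(∑ i, F (l i) t) / n - ∫ ω, F ω t ∂P|
          ≤ |(∑ i, F (l i) t) / n - (∑ i, F (l i) (g ⌊x⌋₊)) / n|
            + |(∑ i, F (l i) (g ⌊x⌋₊)) / n - ∫ ω, F ω (g ⌊x⌋₊) ∂P|
            + |∫ ω, F ω t ∂P - ∫ ω, F ω (g ⌊x⌋₊) ∂P| := by
        rw [abs_sub_comm (∫ ω, F ω t ∂P)]
        exact (abs_sub_le _ _ _).trans (by gcongr; exact abs_sub_le _ _ _)
      linarith
  have hreal : Q.real (⋃ j ∈ Finset.range (n + 1), E j) ≤ 1 / n := by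
    refine (measureReal_biUnion_finset_le _ _).trans
      ((Finset.sum_le_sum fun j _ => hE j).trans ?_)
    have h7 : 2 * ((n : ℝ) + 1) ≤ n ^ 7 := by
      have h2 : 2 * ((n : ℝ) + 1) ≤ n ^ 2 := by nlinarith
      exact h2.trans (pow_le_pow_right₀ (by linarith) (by norm_num))
    simp only [Finset.sum_const, Finset.card_range, nsmul_eq_mul]
    rw [← mul_assoc, mul_one_div, div_le_div_iff₀ (by positivity) hn0]
    push_cast
    calc
      ((n : ℝ) + 1) * 2 * n = 2 * (n + 1) * n := by ring
      _ ≤ n ^ 7 * n := by gcongr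
      _ = 1 * n ^ 8 := by ring
  calc
    _ ≤ Q (⋃ j ∈ Finset.range (n + 1), E j) := measure_mono_ae hcover
    _ = ENNReal.ofReal (Q.real (⋃ j ∈ Finset.range (n + 1), E j)) := by simp
    _ ≤ ENNReal.ofReal (1 / n) := ENNReal.ofReal_le_ofReal hreal
    _ = 1 / n := by rw [ENNReal.ofReal_div_of_pos hn0]; simp

theorem isClosed_setOf_isLandscapeType (T : ℝ) :
    IsClosed {f : C(ℝ, ℝ) | IsLandscapeType T f} := by
  have hev (t : ℝ) : Continuous fun f : C(ℝ, ℝ) => f t := continuous_eval_const t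
  simp only [IsLandscapeType, lipschitzWith_iff_dist_le_mul, Set.ofPred_and, Set.ofPred_forall]
  refine .inter ?_ (.inter ?_ ?_)
  · exact isClosed_iInter fun x => isClosed_iInter fun y =>
      isClosed_le ((hev x).dist (hev y)) continuous_const
  · exact isClosed_iInter fun t => .inter (isClosed_le continuous_const (hev t))
      (isClosed_le (hev t) continuous_const)
  · exact isClosed_iInter fun t => isClosed_iInter fun _ => isClosed_eq (hev t) continuous_const

theorem abs_sqrt_div_sqrt_sub_one_le {u v c : ℝ} (hc : 0 < c) (hv : c ≤ Real.sqrt v) :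
    |Real.sqrt u / Real.sqrt v - 1| ≤ |u - v| / c ^ 2 := by
  have hv0 : 0 < Real.sqrt v := hc.trans_le hv
  have hvpos : 0 < v := Real.sqrt_pos.1 hv0
  have hu0 := Real.sqrt_nonneg u
  have hdiff : |Real.sqrt u - Real.sqrt v| * c ≤ |u - v| := by
    have hclamp : |max u 0 - v| ≤ |u - v| := by
      simpa [max_eq_left hvpos.le] using abs_max_sub_max_le_abs u v 0
    have hsq : max u 0 - v = (Real.sqrt u - Real.sqrt v) * (Real.sqrt u + Real.sqrt v) := by
      have hsu : Real.sqrt u ^ 2 = max u 0 := by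
        rcases le_total 0 u with h | h
        · rw [Real.sq_sqrt h, max_eq_left h]
        · rw [Real.sqrt_eq_zero_of_nonpos h, max_eq_right h]; norm_num
      linear_combination -hsu + Real.sq_sqrt hvpos.le
    refine le_trans ?_ hclamp
    rw [hsq, abs_mul, abs_of_nonneg (by linarith : 0 ≤ Real.sqrt u + Real.sqrt v)]
    gcongr
    linarith
  rw [div_sub_one hv0.ne', abs_div, abs_of_pos hv0, div_le_div_iff₀ hv0 (by positivity)]
  calc
    _ = |Real.sqrt u - Real.sqrt v| * c * c := by ring
    _ ≤ |u - v| * Real.sqrt v := by gcongr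

/-- If `σ(t) ≥ c > 0` on `[t₁, t₂] ⊆ [0, T]` then there are `C > 0` and `N₀` such that for
all `n ≥ N₀`, under the `n`-fold product measure `Pⁿ` (i.i.d. sample `λ_1, …, λ_n ~ P`),
`Pⁿ(sup_{t ∈ [t₁,t₂]} |σ̂_n(t)/σ(t) − 1| ≥ C (log n)^{1/2} n^{−1/2}) ≤ 2/n`. -/
theorem empirical_sd_ratio (T : ℝ) (hT : 0 < T)
    (P : Measure C(ℝ, ℝ)) [IsProbabilityMeasure P]
    (hP : P {f | IsLandscapeType T f} = 1)
    (t₁ t₂ c : ℝ) (ht₁ : 0 ≤ t₁) (h₁₂ : t₁ < t₂) (ht₂ : t₂ ≤ T) (hc : 0 < c)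
    (hσ : ∀ t ∈ Icc t₁ t₂, c ≤ lsd P t) :
    ∃ C > (0 : ℝ), ∃ N₀ : ℕ, ∀ n ≥ N₀,
      (Measure.pi fun _ : Fin n => P)
        {l | C * Real.sqrt (Real.log n) / Real.sqrt n
              ≤ ⨆ t : Icc t₁ t₂, |empSD n l ↑t / lsd P ↑t - 1|}
        ≤ 2 / n := by
  have hae : ∀ᵐ f : C(ℝ, ℝ) ∂P, IsLandscapeType T f :=
    (mem_ae_iff_prob_eq_one (isClosed_setOf_isLandscapeType T).measurableSet).2 hP
  have hmeas (t : ℝ) : Measurable fun f : C(ℝ, ℝ) => f t := (continuous_eval_const t).measurable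
  have hlip {f : C(ℝ, ℝ)} (hf : IsLandscapeType T f) (s t : ℝ) : |f s - f t| ≤ |s - t| := by
    simpa [Real.dist_eq] using hf.1.dist_le_mul s t
  set A₁ : ℝ := 2 * (T / 2) + 2 * 1 * (t₂ - t₁) with hA₁
  set A₂ : ℝ := 2 * (T / 2) ^ 2 + 2 * T * (t₂ - t₁) with hA₂
  have hL : 0 < t₂ - t₁ := sub_pos.2 h₁₂
  have hA₁0 : 0 < A₁ := by positivity
  have hA₂0 : 0 < A₂ := by positivity
  refine ⟨(A₂ + T * A₁) / c ^ 2 + 1, by positivity, 3, fun n hn => ?_⟩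
  have hn0 : (0 : ℝ) < n := by exact_mod_cast (by omega : 0 < n)
  have hmean := measure_pi_exists_deviation_ge_le P (F := fun f t => f t) hmeas (B := T / 2)
    (K := 1) (by positivity) zero_le_one h₁₂ (hae.mono fun f hf => hf.2.1)
    (hae.mono fun f hf s t => by simpa using hlip (f := f) hf s t) hn
  have hsq := measure_pi_exists_deviation_ge_le P (F := fun f t => f t ^ 2)
    (fun t => (hmeas t).pow_const 2) (B := (T / 2) ^ 2) (K := T) (by positivity) hT.le h₁₂
    (hae.mono fun f hf t => ⟨sq_nonneg _, by
      have := hf.2.1 t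
      gcongr
      exacts [this.1, this.2]⟩)
    (hae.mono fun f hf s t => by
      have hs := hf.2.1 s
      have ht := hf.2.1 t
      rw [sq_sub_sq, abs_mul, abs_of_nonneg (by linarith)]
      exact mul_le_mul (by linarith) (hlip (f := f) hf s t) (abs_nonneg _) hT.le) hn
  rw [← hA₁] at hmean
  rw [← hA₂] at hsq
  set r : ℝ := Real.sqrt (Real.log n) / Real.sqrt n with hr
  have hr0 : 0 < r := lt_of_lt_of_le (by positivity) (one_div_le_sqrt_log_div_sqrt hn)
  set Q : Measure (Fin n → C(ℝ, ℝ)) := Measure.pi fun _ : Fin n => P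
  have haeQ : ∀ᵐ l ∂Q, ∀ i, IsLandscapeType T (l i) :=
    ae_all_iff.2 fun i =>
      (measurePreserving_eval (fun _ : Fin n => P) i).quasiMeasurePreserving.ae hae
  have hmean_mem (t : ℝ) : lmean P t ∈ Icc 0 (T / 2) := by
    refine ⟨integral_nonneg_of_ae (hae.mono fun f hf => (hf.2.1 t).1), ?_⟩
    have h := integral_mono_of_nonneg (hae.mono fun f hf => (hf.2.1 t).1)
      (integrable_const (T / 2)) (hae.mono fun f hf => (hf.2.1 t).2)
    simpa [lmean] using h
  refine (measure_mono_ae (?_ : _ ≤ᵐ[Q] ({l | ∃ t ∈ Icc t₁ t₂,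
    A₁ * r ≤ |(∑ i, l i t) / n - ∫ f, f t ∂P|} ∪ {l | ∃ t ∈ Icc t₁ t₂,
    A₂ * r ≤ |(∑ i, l i t ^ 2) / n - ∫ f, f t ^ 2 ∂P|} : Set (Fin n → C(ℝ, ℝ))))).trans
    ((measure_union_le _ _).trans ((add_le_add hmean hsq).trans_eq ?_))
  · filter_upwards [haeQ] with l hl hlarge
    by_contra hgood
    have hgood₁ (t : ℝ) (ht : t ∈ Icc t₁ t₂) :
        |(∑ i, l i t) / n - ∫ f, f t ∂P| < A₁ * r :=
      lt_of_not_ge fun h => hgood (Or.inl ⟨t, ht, h⟩)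
    have hgood₂ (t : ℝ) (ht : t ∈ Icc t₁ t₂) :
        |(∑ i, l i t ^ 2) / n - ∫ f, f t ^ 2 ∂P| < A₂ * r :=
      lt_of_not_ge fun h => hgood (Or.inr ⟨t, ht, h⟩)
    have hlarge' : ((A₂ + T * A₁) / c ^ 2 + 1) * Real.sqrt (Real.log n) / Real.sqrt n
      ≤ ⨆ t : Icc t₁ t₂, |empSD n l ↑t / lsd P ↑t - 1| := hlarge
    rw [mul_div_assoc, ← hr] at hlarge'
    have : Nonempty (Icc t₁ t₂) := ⟨⟨t₁, le_rfl, h₁₂.le⟩⟩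
    have hsup : ⨆ t : Icc t₁ t₂, |empSD n l ↑t / lsd P ↑t - 1| ≤ (A₂ + T * A₁) / c ^ 2 * r := by
      refine ciSup_le fun ⟨t, ht⟩ => ?_
      refine (abs_sqrt_div_sqrt_sub_one_le hc (hσ t ht)).trans ?_
      rw [div_mul_eq_mul_div]
      gcongr
      have hemp : empMean n l t ∈ Icc 0 (T / 2) := by
        refine ⟨div_nonneg (Finset.sum_nonneg fun i _ => ((hl i).2.1 t).1) hn0.le, ?_⟩
        rw [empMean, div_le_iff₀ hn0]
        refine (Finset.sum_le_sum fun i _ => ((hl i).2.1 t).2).trans_eq ?_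
        simp [mul_comm]
      have h₁ : |empMean n l t - lmean P t| < A₁ * r := hgood₁ t ht
      have h₂ := hgood₂ t ht
      have hm := hmean_mem t
      have h₃ : |empMean n l t ^ 2 - lmean P t ^ 2| ≤ T * (A₁ * r) := by
        rw [sq_sub_sq, abs_mul, abs_of_nonneg (add_nonneg hemp.1 hm.1)]
        gcongr
        linarith [hemp.2, hm.2]
      calc
        _ = |((∑ i, l i t ^ 2) / n - ∫ f, f t ^ 2 ∂P)
              - (empMean n l t ^ 2 - lmean P t ^ 2)| := by
            rw [lvar]
            congr 1
            ring
        _ ≤ _ := abs_sub _ _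
        _ ≤ (A₂ + T * A₁) * r := by linarith
    linarith
  · rw [← ENNReal.add_div, one_add_one_eq_two]
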